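/- arXiv:2401.02182 — 2 statements merged into one kernel-verified Lean document; each statement's English description precedes it below -/
import Mathlib

section
/- Let k, m, n be positive integers, r an integer, and γ ∈ Γ^J. Then for every (τ,z) ∈ D' such that γ·(τ,z) ∈ D', (∂^J((q^nζ^r)|_{k,m}γ))(τ,z) = ((∂^J(q^nζ^r))|_{k+2,m}γ)(τ,z), where ∂^Jψ = D_τψ − (k/12)E₂ψ + (1/(1−4m))(D_z²ψ − J₁D_zψ + mJ₂ψ − (m/6)E₂ψ) is the Jacobi–Serre derivative of weight k and index m. -/
noncomputable section

open Complex MeasureTheory Set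
open scoped ComplexConjugate

/-- `e w = exp (2 π i w)`. -/
def e (w : ℂ) : ℂ := Complex.exp (2 * (Real.pi : ℂ) * Complex.I * w)

/-- The monomial `q^n ζ^r`, i.e. `(τ, z) ↦ e^{2πi(nτ + rz)}`. -/
def Qmon (n : ℕ) (r : ℤ) (τ z : ℂ) : ℂ := e ((n : ℂ) * τ + (r : ℂ) * z)

/-- `σ₁(n)`, the sum of the positive divisors of `n`. -/
def sigma1 (n : ℕ) : ℕ := ∑ d ∈ n.divisors, d

/-- The weight-2 Eisenstein series `E₂(τ) = 1 - 24 ∑_{n ≥ 1} σ₁(n) e^{2πinτ}`. -/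
def E2 (τ : ℂ) : ℂ := 1 - 24 * ∑' n : ℕ, (sigma1 (n + 1) : ℂ) * e (((n : ℂ) + 1) * τ)

/-- The deformed Eisenstein series
`J₁(τ,z) = ζ/(ζ-1) - 1/2 - ∑_{a,b ≥ 1} (ζ^a - ζ^{-a}) q^{ab}`. -/
def J1 (τ z : ℂ) : ℂ :=
  e z / (e z - 1) - 1 / 2 -
    ∑' p : ℕ × ℕ, (e (((p.1 : ℂ) + 1) * z) - e (-(((p.1 : ℂ) + 1) * z))) *
      e (((p.1 : ℂ) + 1) * ((p.2 : ℂ) + 1) * τ)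

/-- The deformed Eisenstein series
`J₂(τ,z) = 1/6 - 2 ∑_{a,b ≥ 1} b (ζ^a + ζ^{-a}) q^{ab}`. -/
def J2 (τ z : ℂ) : ℂ :=
  1 / 6 - 2 * ∑' p : ℕ × ℕ, ((p.2 : ℂ) + 1) *
      (e (((p.1 : ℂ) + 1) * z) + e (-(((p.1 : ℂ) + 1) * z))) *
      e (((p.1 : ℂ) + 1) * ((p.2 : ℂ) + 1) * τ)

/-- `D_τ = (1/2πi) ∂/∂τ`. -/
def Dt (φ : ℂ → ℂ → ℂ) : ℂ → ℂ → ℂ :=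
  fun τ z => (1 / (2 * (Real.pi : ℂ) * Complex.I)) * deriv (fun t => φ t z) τ

/-- `D_z = (1/2πi) ∂/∂z`. -/
def Dz (φ : ℂ → ℂ → ℂ) : ℂ → ℂ → ℂ :=
  fun τ z => (1 / (2 * (Real.pi : ℂ) * Complex.I)) * deriv (fun w => φ τ w) z

/-- The slash action `φ ↦ φ|_{k,m} γ` for `γ = ((a,b;c,d),(λ,μ)) ∈ Γ^J`. -/
def slash (k m : ℤ) (a b c d lam mu : ℤ) (φ : ℂ → ℂ → ℂ) (τ z : ℂ) : ℂ :=
  ((c : ℂ) * τ + (d : ℂ)) ^ (-k) *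
    e ((m : ℂ) * (-(c : ℂ) * (z + (lam : ℂ) * τ + (mu : ℂ)) ^ 2 / ((c : ℂ) * τ + (d : ℂ)) +
        (lam : ℂ) ^ 2 * τ + 2 * (lam : ℂ) * z)) *
    φ (((a : ℂ) * τ + (b : ℂ)) / ((c : ℂ) * τ + (d : ℂ)))
      ((z + (lam : ℂ) * τ + (mu : ℂ)) / ((c : ℂ) * τ + (d : ℂ)))

/-- The domain `D' = {(τ,z) : 0 < Im τ, |Im z| < Im τ, e^{2πiz} ≠ 1}`. -/
def D' : Set (ℂ × ℂ) := {p | 0 < p.1.im ∧ |p.2.im| < p.1.im ∧ e p.2 ≠ 1}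

/-- The Oberdieck derivative `Oφ = D_τφ - (k/12)E₂φ - J₁D_zφ + mJ₂φ` of weight `k`, index `m`. -/
def Ober (k m : ℕ) (φ : ℂ → ℂ → ℂ) : ℂ → ℂ → ℂ :=
  fun τ z => Dt φ τ z - ((k : ℂ) / 12) * E2 τ * φ τ z - J1 τ z * Dz φ τ z +
    (m : ℂ) * J2 τ z * φ τ z

/-- The heat operator `L_m = 4m D_τ - D_z²`. -/
def Heat (m : ℕ) (φ : ℂ → ℂ → ℂ) : ℂ → ℂ → ℂ :=
  fun τ z => 4 * (m : ℂ) * Dt φ τ z - Dz (Dz φ) τ z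

/-- The modified heat operator `L_{k,m} = L_m - (m(2k-1)/6) E₂`. -/
def HeatE (k m : ℕ) (φ : ℂ → ℂ → ℂ) : ℂ → ℂ → ℂ :=
  fun τ z => Heat m φ τ z - (m : ℂ) * (2 * (k : ℂ) - 1) / 6 * E2 τ * φ τ z

/-- The Jacobi–Serre derivative of weight `k` and index `m`. -/
def JSerre (k m : ℕ) (φ : ℂ → ℂ → ℂ) : ℂ → ℂ → ℂ :=
  fun τ z => Dt φ τ z - ((k : ℂ) / 12) * E2 τ * φ τ z +
    (1 / (1 - 4 * (m : ℂ))) *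
      (Dz (Dz φ) τ z - J1 τ z * Dz φ τ z + (m : ℂ) * J2 τ z * φ τ z -
        ((m : ℂ) / 6) * E2 τ * φ τ z)

/-- The error function `erf a = (2/√π) ∫₀^a e^{-t²} dt`. -/
def erf (a : ℝ) : ℝ := 2 / Real.sqrt Real.pi * ∫ t in (0 : ℝ)..a, Real.exp (-t ^ 2)

/-- Euler's integral for `₂F₁(1/2, k+1; 3/2; x)`:
`F_k(x) = (1/2) ∫₀¹ t^{-1/2} (1 - xt)^{-(k+1)} dt`. -/
def Fk (k x : ℝ) : ℝ := (1 / 2) * ∫ t in (0 : ℝ)..1, t ^ (-(1 : ℝ) / 2) * (1 - x * t) ^ (-(k + 1))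

/-- The integration region `(u,v,x,y) ∈ [0,1] × (0,∞) × [0,1] × ℝ`. -/
def Reg : Set (ℝ × ℝ × ℝ × ℝ) := Icc 0 1 ×ˢ Ioi 0 ×ˢ Icc 0 1 ×ˢ univ

/-- The Fourier series `φ(τ,z) = ∑_{n,r} c(n,r) q^n ζ^r`. -/
def phiF (c : ℕ → ℤ → ℂ) (τ z : ℂ) : ℂ :=
  ∑' p : ℕ × ℤ, c p.1 p.2 * e ((p.1 : ℂ) * τ + (p.2 : ℂ) * z)

open Filter Topology

lemma e_add (u v : ℂ) : e (u + v) = e u * e v := by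
  simp only [e, mul_add, Complex.exp_add]

lemma e_zero : e 0 = 1 := by simp [e]

lemma e_ne_zero (u : ℂ) : e u ≠ 0 := Complex.exp_ne_zero _

lemma e_neg (u : ℂ) : e (-u) = (e u)⁻¹ := by
  simp only [e, mul_neg, Complex.exp_neg]

lemma e_natCast_mul (n : ℕ) (u : ℂ) : e (n * u) = e u ^ n := by
  rw [e, e, ← Complex.exp_nat_mul]
  ring_nf

lemma e_intCast (n : ℤ) : e n = 1 := by
  rw [e, Complex.exp_eq_one_iff]
  exact ⟨n, by ring⟩

lemma e_eq_one_iff (u : ℂ) : e u = 1 ↔ ∃ n : ℤ, u = n := by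
  rw [e, Complex.exp_eq_one_iff]
  refine exists_congr fun n => ?_
  rw [mul_comm (n : ℂ), mul_right_inj' Complex.two_pi_I_ne_zero]

lemma e_add_intCast (u : ℂ) (n : ℤ) : e (u + n) = e u := by
  rw [e_add, e_intCast, mul_one]

lemma norm_e (u : ℂ) : ‖e u‖ = Real.exp (-(2 * Real.pi * u.im)) := by
  rw [e, Complex.norm_exp]
  simp

lemma norm_e_lt_one {u : ℂ} (hu : 0 < u.im) : ‖e u‖ < 1 := by
  rw [norm_e, Real.exp_lt_one_iff]
  have := Real.pi_pos
  nlinarith [mul_pos this hu]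

lemma e_ne_one_of_im_pos {u : ℂ} (hu : 0 < u.im) : e u ≠ 1 := by
  intro h
  have := norm_e_lt_one hu
  simp [h] at this

lemma hasDerivAt_e (u : ℂ) : HasDerivAt e (2 * Real.pi * I * e u) u := by
  unfold e
  simpa [mul_comm] using ((hasDerivAt_id u).const_mul (2 * (Real.pi : ℂ) * I)).cexp

lemma differentiable_e : Differentiable ℂ e := fun u => (hasDerivAt_e u).differentiableAt

/-- The summand `b^w ζ^a q^{ab}`, with `a` and `b` shifted by one. -/
def lambertTerm (w : ℕ) (τ z : ℂ) (p : ℕ × ℕ) : ℂ :=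
  ((p.2 : ℂ) + 1) ^ w * (e (((p.1 : ℂ) + 1) * z) * e (((p.1 : ℂ) + 1) * ((p.2 : ℂ) + 1) * τ))

/-- The series `∑_{a,b ≥ 1} b^w ζ^a q^{ab}`. -/
def lambert (w : ℕ) (τ z : ℂ) : ℂ := ∑' p, lambertTerm w τ z p

/-- A summable majorant of `lambertTerm w τ z` on the half-plane `-y < Im z`. -/
def lambertBound (w : ℕ) (T y : ℝ) (p : ℕ × ℕ) : ℝ :=
  Real.exp (-(2 * Real.pi * (T - y))) ^ (p.1 + 1) *
    (((p.2 : ℝ) + 1) ^ w * Real.exp (-(2 * Real.pi * T)) ^ p.2)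

lemma summable_lambertBound (w : ℕ) {T y : ℝ} (hT : 0 < T) (hy : y < T) :
    Summable (lambertBound w T y) := by
  have hpi := Real.pi_pos
  have h1 : Real.exp (-(2 * Real.pi * (T - y))) < 1 := by
    rw [Real.exp_lt_one_iff]; nlinarith [mul_pos hpi (sub_pos.2 hy)]
  have h2 : Real.exp (-(2 * Real.pi * T)) < 1 := by
    rw [Real.exp_lt_one_iff]; nlinarith [mul_pos hpi hT]
  refine Summable.mul_of_nonneg (f := fun i : ℕ => Real.exp (-(2 * Real.pi * (T - y))) ^ (i + 1))
    (g := fun j : ℕ => ((j : ℝ) + 1) ^ w * Real.exp (-(2 * Real.pi * T)) ^ j) ?_ ?_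
    (fun i => by positivity) (fun j => by positivity)
  · exact (summable_nat_add_iff 1).2 (summable_geometric_of_lt_one (Real.exp_pos _).le h1)
  · have h := (summable_nat_add_iff 1).2 (summable_pow_mul_geometric_of_norm_lt_one (R := ℝ) w
      (r := Real.exp (-(2 * Real.pi * T))) (by rwa [Real.norm_of_nonneg (Real.exp_pos _).le]))
    refine (h.mul_right (Real.exp (-(2 * Real.pi * T)))⁻¹).congr fun j => ?_
    have := (Real.exp_pos (-(2 * Real.pi * T))).ne'
    push_cast
    field_simp
    exact _root_.pow_succ' _ _

lemma norm_lambertTerm_le (w : ℕ) {τ z : ℂ} {y : ℝ} (hτ : 0 < τ.im) (hz : -y < z.im) (p : ℕ × ℕ) :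
    ‖lambertTerm w τ z p‖ ≤ lambertBound w τ.im y p := by
  have hpi := Real.pi_pos
  have hn : ‖(p.2 : ℂ) + 1‖ = (p.2 : ℝ) + 1 := by
    rw [← Nat.cast_add_one, Complex.norm_natCast]; push_cast; rfl
  have h1 : (((p.1 : ℂ) + 1) * z).im = ((p.1 : ℝ) + 1) * z.im := by simp
  have h2 : (((p.1 : ℂ) + 1) * ((p.2 : ℂ) + 1) * τ).im
      = ((p.1 : ℝ) + 1) * ((p.2 : ℝ) + 1) * τ.im := by simp
  rw [lambertTerm, norm_mul, norm_mul, norm_pow, norm_e, norm_e, lambertBound, ← Real.exp_nat_mul,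
    ← Real.exp_nat_mul, hn, h1, h2, ← Real.exp_add, mul_left_comm (Real.exp _), ← Real.exp_add]
  refine mul_le_mul_of_nonneg_left (Real.exp_le_exp.2 ?_) (by positivity)
  push_cast
  have h3 : 0 ≤ ((p.1 : ℝ) + 1) * (z.im + y) := mul_nonneg (by positivity) (by linarith)
  have h4 : 0 ≤ (p.1 : ℝ) * p.2 * τ.im := by positivity
  nlinarith [mul_nonneg hpi.le h3, mul_nonneg hpi.le h4]

lemma summable_lambertTerm (w : ℕ) {τ z : ℂ} (hτ : 0 < τ.im) (hz : -τ.im < z.im) :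
    Summable (lambertTerm w τ z) := by
  obtain ⟨y, hy1, hy2⟩ := exists_between (show -z.im < τ.im by linarith)
  exact Summable.of_norm_bounded (summable_lambertBound w hτ hy2)
    (norm_lambertTerm_le w hτ (by linarith))

lemma differentiable_lambertTerm (w : ℕ) (τ : ℂ) (p : ℕ × ℕ) :
    Differentiable ℂ (fun z => lambertTerm w τ z p) := by
  unfold lambertTerm
  have := differentiable_e
  exact ((this.comp (differentiable_id.const_mul _)).mul_const _).const_mul _

lemma differentiableAt_lambert (w : ℕ) {τ z : ℂ} (hτ : 0 < τ.im) (hz : -τ.im < z.im) :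
    DifferentiableAt ℂ (lambert w τ) z := by
  obtain ⟨y, hy1, hy2⟩ := exists_between (show -z.im < τ.im by linarith)
  exact (differentiableOn_tsum_of_summable_norm (U := {z : ℂ | -y < z.im})
    (summable_lambertBound w hτ hy2) (fun p => (differentiable_lambertTerm w τ p).differentiableOn)
    (Complex.isOpen_im_gt _) (fun p v hv => norm_lambertTerm_le w hτ hv p)).differentiableAt
    ((Complex.isOpen_im_gt _).mem_nhds (show -y < z.im by linarith))

lemma lambertTerm_add (w : ℕ) (τ z : ℂ) (i j : ℕ) :
    lambertTerm w τ (z + τ) (i, j) =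
      ((j : ℂ) + 1) ^ w * (e ((i + 1) * z) * e (((i : ℂ) + 1) * ((j + 1 : ℕ) + 1) * τ)) := by
  rw [lambertTerm, ← e_add, ← e_add]
  congr 2
  push_cast
  ring

/-- The shift `z ↦ z + τ` of the unweighted series. -/
lemma lambert_zero_add {τ z : ℂ} (hτ : 0 < τ.im) (hz : -τ.im < z.im) :
    lambert 0 τ (z + τ) = lambert 0 τ z - e (z + τ) / (1 - e (z + τ)) := by
  have hz' : 0 < (z + τ).im := by simp; linarith
  have hs := summable_lambertTerm 0 hτ hz
  have hs' := summable_lambertTerm 0 hτ (z := z + τ) (by linarith)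
  have hg := (hasSum_geometric_of_norm_lt_one (norm_e_lt_one hz')).mul_left (e (z + τ))
  rw [lambert, lambert, hs.tsum_prod, hs'.tsum_prod, eq_sub_iff_add_eq, div_eq_mul_inv,
    ← hg.tsum_eq, ← (hs'.prod).tsum_add hg.summable]
  refine tsum_congr fun i => ?_
  rw [(hs.prod_factor i).tsum_eq_zero_add, add_comm]
  congr 1
  · rw [lambertTerm, ← _root_.pow_succ', ← e_natCast_mul, pow_zero, one_mul, ← e_add]
    push_cast
    ring_nf
  · refine tsum_congr fun j => ?_
    rw [lambertTerm_add, lambertTerm]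
    simp

/-- The shift `z ↦ z + τ` of the series with weight one. -/
lemma lambert_one_add {τ z : ℂ} (hτ : 0 < τ.im) (hz : -τ.im < z.im) :
    lambert 1 τ (z + τ) = lambert 1 τ z - lambert 0 τ z := by
  have hz' : 0 < (z + τ).im := by simp; linarith
  have hs0 := summable_lambertTerm 0 hτ hz
  have hs1 := summable_lambertTerm 1 hτ hz
  have hs' := summable_lambertTerm 1 hτ (z := z + τ) (by linarith)
  have hs := hs1.sub hs0
  rw [lambert, lambert, lambert, ← hs1.tsum_sub hs0, hs.tsum_prod, hs'.tsum_prod]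
  refine tsum_congr fun i => ?_
  rw [(hs.prod_factor i).tsum_eq_zero_add]
  simp only [lambertTerm_add]
  simp [lambertTerm, ← sub_one_mul]

lemma lambertTerm_zero_swap (τ : ℂ) (p : ℕ × ℕ) :
    lambertTerm 1 τ 0 p.swap =
      ((p.1 : ℂ) + 1) * e (((p.1 : ℂ) + 1) * ((p.2 : ℂ) + 1) * τ) := by
  simp only [lambertTerm, Prod.fst_swap, Prod.snd_swap, mul_zero, e_zero, pow_one, one_mul]
  rw [mul_comm ((p.2 : ℂ) + 1)]

lemma deriv_lambert_zero {τ : ℂ} (hτ : 0 < τ.im) :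
    deriv (lambert 0 τ) 0 = 2 * Real.pi * I * lambert 1 τ 0 := by
  obtain ⟨y, hy1, hy2⟩ := exists_between hτ
  have h := hasSum_deriv_of_summable_norm (U := {z : ℂ | -y < z.im}) (z := 0)
    (summable_lambertBound 0 hτ hy2) (fun p => (differentiable_lambertTerm 0 τ p).differentiableOn)
    (Complex.isOpen_im_gt _) (fun p v hv => norm_lambertTerm_le 0 hτ hv p) (by simpa using hy1)
  rw [show lambert 0 τ = fun z => ∑' p, lambertTerm 0 τ z p from rfl, ← h.tsum_eq, lambert,
    ← tsum_mul_left, ← (Equiv.prodComm ℕ ℕ).tsum_eq (fun p => 2 * Real.pi * I * lambertTerm 1 τ 0 p)]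
  refine tsum_congr fun p => ?_
  rw [Equiv.prodComm_apply, lambertTerm_zero_swap]
  unfold lambertTerm
  have hd : HasDerivAt (fun z : ℂ => e (((p.1 : ℂ) + 1) * z))
      (2 * Real.pi * I * e (((p.1 : ℂ) + 1) * 0) * (((p.1 : ℂ) + 1) * 1)) 0 :=
    (hasDerivAt_e _).comp (0 : ℂ) ((hasDerivAt_id (0 : ℂ)).const_mul ((p.1 : ℂ) + 1))
  have := ((hd.mul_const (e (((p.1 : ℂ) + 1) * ((p.2 : ℂ) + 1) * τ))).const_mul
    (((p.2 : ℂ) + 1) ^ 0)).deriv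
  rw [this]
  simp [e_zero]
  ring

lemma lambert_one_zero {τ : ℂ} (hτ : 0 < τ.im) :
    lambert 1 τ 0 = ∑' n : ℕ, (sigma1 (n + 1) : ℂ) * e (((n : ℂ) + 1) * τ) := by
  have hq := norm_e_lt_one hτ
  have hE (n : ℕ) : e (((n : ℂ) + 1) * τ) = e τ ^ (n + 1) := by
    rw [← e_natCast_mul]; push_cast; rfl
  have h := tsum_prod_pow_eq_tsum_sigma 1 hq
  rw [tsum_pnat_eq_tsum_succ (f := fun d : ℕ => ∑' c : ℕ+, (c : ℂ) ^ 1 * e τ ^ (d * c : ℕ)),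
    tsum_pnat_eq_tsum_succ (f := fun d : ℕ => (ArithmeticFunction.sigma 1 d : ℂ) * e τ ^ d)] at h
  rw [lambert, (summable_lambertTerm 1 hτ (by simpa using hτ)).tsum_prod]
  convert h using 1
  · refine tsum_congr fun i => ?_
    rw [tsum_pnat_eq_tsum_succ (f := fun c : ℕ => (c : ℂ) ^ 1 * e τ ^ ((i + 1) * c : ℕ))]
    refine tsum_congr fun j => ?_
    rw [lambertTerm, ← e_natCast_mul]
    simp [e_zero]
  · refine tsum_congr fun n => ?_
    rw [hE]
    simp [sigma1, ArithmeticFunction.sigma_one_apply]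

lemma E2_eq {τ : ℂ} (hτ : 0 < τ.im) : E2 τ = 1 - 24 * lambert 1 τ 0 := by
  rw [E2, lambert_one_zero hτ]

lemma E2_eq_eisensteinSeries (τ : UpperHalfPlane) : E2 τ = EisensteinSeries.E2 τ := by
  rw [EisensteinSeries.E2_eq_tsum_cexp, E2,
    tsum_pnat_eq_tsum_succ (f := fun d : ℕ => (ArithmeticFunction.sigma 1 d : ℂ) *
      cexp (2 * Real.pi * I * τ) ^ d)]
  congr 2
  refine tsum_congr fun n => ?_
  have : e (((n : ℂ) + 1) * τ) = e τ ^ (n + 1) := by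
    rw [← e_natCast_mul]; push_cast; rfl
  rw [this]
  simp [sigma1, ArithmeticFunction.sigma_one_apply, e]

lemma E2_transform {a b c d : ℤ} (hdet : a * d - b * c = 1) {τ : ℂ} (hτ : 0 < τ.im) :
    E2 ((a * τ + b) / (c * τ + d)) =
      (c * τ + d) ^ 2 * E2 τ + 12 * c * (c * τ + d) / (2 * Real.pi * I) := by
  let γ : Matrix.SpecialLinearGroup (Fin 2) ℤ :=
    ⟨!![a, b; c, d], by rw [Matrix.det_fin_two_of]; exact hdet⟩
  let t : UpperHalfPlane := ⟨τ, hτ⟩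
  have h := congrFun (EisensteinSeries.E2_slash_action γ) t
  rw [ModularForm.SL_slash_apply] at h
  have hden : UpperHalfPlane.denom γ t = c * τ + d := by
    rw [ModularGroup.denom_apply]
    rfl
  have hne : (c * τ + d : ℂ) ≠ 0 := hden ▸ UpperHalfPlane.denom_ne_zero _ t
  have hsm : ((γ • t : UpperHalfPlane) : ℂ) = (a * τ + b) / (c * τ + d) := by
    rw [UpperHalfPlane.specialLinearGroup_apply]
    simp [γ, t]
  rw [← E2_eq_eisensteinSeries, hsm, hden] at h
  simp only [Pi.sub_apply, Pi.smul_apply, EisensteinSeries.D2, hden, smul_eq_mul,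
    ← E2_eq_eisensteinSeries, riemannZeta_two] at h
  have h10 : γ 1 0 = c := rfl
  have ht : (t : ℂ) = τ := rfl
  rw [h10, ht] at h
  have hpi : (Real.pi : ℂ) ≠ 0 := by exact_mod_cast Real.pi_ne_zero
  rw [zpow_neg, zpow_ofNat, ← div_eq_mul_inv, div_eq_iff (pow_ne_zero 2 hne)] at h
  rw [h]
  field_simp
  linear_combination (-12 : ℂ) * c * Complex.I_sq

lemma e_add_one (u : ℂ) : e (u + 1) = e u := by
  exact_mod_cast e_add_intCast u 1

lemma J1_eq {τ z : ℂ} (hz : |z.im| < τ.im) :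
    J1 τ z = e z / (e z - 1) - 1 / 2 - (lambert 0 τ z - lambert 0 τ (-z)) := by
  obtain ⟨h1, h2⟩ := abs_lt.1 hz
  have hτ : 0 < τ.im := by linarith
  rw [J1, lambert, lambert, ← (summable_lambertTerm 0 hτ h1).tsum_sub
    (summable_lambertTerm 0 hτ (by rw [neg_im]; linarith))]
  refine congrArg _ (tsum_congr fun p => ?_)
  rw [lambertTerm, lambertTerm, mul_neg]
  ring

lemma J2_eq {τ z : ℂ} (hz : |z.im| < τ.im) :
    J2 τ z = 1 / 6 - 2 * (lambert 1 τ z + lambert 1 τ (-z)) := by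
  obtain ⟨h1, h2⟩ := abs_lt.1 hz
  have hτ : 0 < τ.im := by linarith
  rw [J2, lambert, lambert, ← (summable_lambertTerm 1 hτ h1).tsum_add
    (summable_lambertTerm 1 hτ (by rw [neg_im]; linarith))]
  refine congrArg (fun s => 1 / 6 - 2 * s) (tsum_congr fun p => ?_)
  rw [lambertTerm, lambertTerm, mul_neg]
  ring

lemma e_mul_add_one (a : ℕ) (z : ℂ) : e (((a : ℂ) + 1) * (z + 1)) = e (((a : ℂ) + 1) * z) := by
  have := e_add_intCast (((a : ℂ) + 1) * z) (a + 1)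
  push_cast at this
  rwa [mul_add_one ((a : ℂ) + 1) z]

lemma J1_add_one (τ z : ℂ) : J1 τ (z + 1) = J1 τ z := by
  simp only [J1, e_add_one, e_neg, e_mul_add_one]

lemma J2_add_one (τ z : ℂ) : J2 τ (z + 1) = J2 τ z := by
  simp only [J2, e_neg, e_mul_add_one]

lemma J1_neg {τ z : ℂ} (hz : |z.im| < τ.im) (h1 : e z ≠ 1) : J1 τ (-z) = -J1 τ z := by
  have h0 := e_ne_zero z
  have h2 : e z - 1 ≠ 0 := sub_ne_zero.2 h1
  have h3 : 1 - e z ≠ 0 := sub_ne_zero.2 h1.symm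
  have h4 : (e z)⁻¹ / ((e z)⁻¹ - 1) = 1 / (1 - e z) := by field_simp
  rw [J1_eq hz, J1_eq (z := -z) (by simpa using hz), neg_neg, e_neg, h4]
  field_simp
  ring

/-- The quantities entering the shift `z ↦ z + τ`, for `z` in the lower half of the strip. -/
lemma lambert_neg_add {τ z : ℂ} (h1 : -τ.im < z.im) (h2 : z.im < 0) :
    lambert 0 τ (-(z + τ)) = lambert 0 τ (-z) + e (-z) / (1 - e (-z)) ∧
    lambert 1 τ (-(z + τ)) = lambert 1 τ (-z) + lambert 0 τ (-z) + e (-z) / (1 - e (-z)) := by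
  have hτ : 0 < τ.im := by linarith
  have h : -(z + τ) + τ = -z := by ring
  have him : -τ.im < (-(z + τ)).im := by simp; linarith
  have h3 := lambert_zero_add hτ him
  have h4 := lambert_one_add hτ him
  rw [h] at h3 h4
  constructor
  · rw [h3]; ring
  · rw [h4, h3]; ring

lemma J1_add_self {τ z : ℂ} (h1 : -τ.im < z.im) (h2 : z.im < 0) :
    J1 τ (z + τ) = J1 τ z - 1 := by
  have hτ : 0 < τ.im := by linarith
  have hx : e (z + τ) ≠ 1 := e_ne_one_of_im_pos (by simp; linarith)
  have hy : e (-z) ≠ 1 := e_ne_one_of_im_pos (by simp; linarith)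
  have hz : e z = (e (-z))⁻¹ := by rw [e_neg, inv_inv]
  rw [J1_eq (z := z) (by rw [abs_lt]; constructor <;> linarith),
    J1_eq (z := z + τ) (by rw [abs_lt]; constructor <;> simp <;> linarith),
    lambert_zero_add hτ h1, (lambert_neg_add h1 h2).1, hz]
  generalize e (z + τ) = x at *
  have h0 := e_ne_zero (-z)
  generalize e (-z) = y at *
  have h3 : x - 1 ≠ 0 := sub_ne_zero.2 hx
  have h4 : 1 - x ≠ 0 := sub_ne_zero.2 hx.symm
  have h5 : 1 - y ≠ 0 := sub_ne_zero.2 hy.symm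
  have h6 : y⁻¹ / (y⁻¹ - 1) = 1 / (1 - y) := by field_simp
  have h7 : x / (x - 1) = - (x / (1 - x)) := by rw [← neg_sub, div_neg]
  have h8 : y / (1 - y) = 1 / (1 - y) - 1 := by field_simp; ring
  rw [h6, h7, h8]
  ring

lemma J2_add_self {τ z : ℂ} (h1 : -τ.im < z.im) (h2 : z.im < 0) :
    J2 τ (z + τ) = J2 τ z - 2 * J1 τ z + 1 := by
  have hτ : 0 < τ.im := by linarith
  have hy : e (-z) ≠ 1 := e_ne_one_of_im_pos (by simp; linarith)
  have hz : e z = (e (-z))⁻¹ := by rw [e_neg, inv_inv]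
  have hs : |z.im| < τ.im := by rw [abs_lt]; constructor <;> linarith
  rw [J2_eq hs, J1_eq hs,
    J2_eq (z := z + τ) (by rw [abs_lt]; constructor <;> simp <;> linarith),
    lambert_one_add hτ h1, (lambert_neg_add h1 h2).2, hz]
  have h0 := e_ne_zero (-z)
  generalize e (-z) = y at *
  have h5 : 1 - y ≠ 0 := sub_ne_zero.2 hy.symm
  have h6 : y⁻¹ / (y⁻¹ - 1) = 1 / (1 - y) := by field_simp
  have h8 : y / (1 - y) = 1 / (1 - y) - 1 := by field_simp; ring
  rw [h6, h8]
  ring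

lemma isOpen_strip (T : ℝ) : IsOpen {z : ℂ | |z.im| < T} :=
  isOpen_lt (continuous_abs.comp Complex.continuous_im) continuous_const

lemma isOpen_e_ne_one : IsOpen {z : ℂ | e z ≠ 1} :=
  isOpen_ne.preimage differentiable_e.continuous

lemma eventually_e_ne_one (z₀ : ℂ) : ∀ᶠ z in 𝓝[≠] z₀, e z ≠ 1 := by
  by_cases h : e z₀ = 1
  · have h' : ∀ᶠ z in 𝓝[≠] z₀, e z ≠ e z₀ := by
      refine (hasDerivAt_e z₀).eventually_ne ?_
      exact mul_ne_zero Complex.two_pi_I_ne_zero (e_ne_zero _)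
    rwa [h] at h'
  · exact nhdsWithin_le_nhds (isOpen_e_ne_one.mem_nhds h)

/-- A doubly periodic function on the strip `|Im z| < Im τ`, holomorphic off the integers and with
removable singularities there, is constant. -/
lemma exists_eq_const_of_doubly_periodic {τ : ℂ} (hτ : 0 < τ.im) {f : ℂ → ℂ}
    (hd : ∀ z, |z.im| < τ.im → e z ≠ 1 → DifferentiableAt ℂ f z)
    (h1 : ∀ z, f (z + 1) = f z)
    (hper : ∀ z, -τ.im < z.im → z.im < 0 → f (z + τ) = f z)
    (h0 : Tendsto (fun z => z * f z) (𝓝[≠] 0) (𝓝 0)) :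
    ∃ C, Tendsto f (𝓝[≠] 0) (𝓝 C) ∧ ∀ z, |z.im| < τ.im → e z ≠ 1 → f z = C := by
  classical
  set S : Set ℂ := {z | |z.im| < τ.im} with hS
  have hSo : IsOpen S := isOpen_strip _
  set L := limUnder (𝓝[≠] (0 : ℂ)) f with hL
  have hmem0 : S ∈ 𝓝 (0 : ℂ) := hSo.mem_nhds (by simpa [hS] using hτ)
  have hd0 : ∀ᶠ z in 𝓝[≠] (0 : ℂ), DifferentiableAt ℂ f z := by
    filter_upwards [eventually_e_ne_one 0, nhdsWithin_le_nhds hmem0] with z hz hzS using hd z hzS hz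
  have ho : (fun z => f z - f 0) =o[𝓝[≠] (0 : ℂ)] fun z => (z - 0)⁻¹ := by
    have hne : ∀ᶠ z in 𝓝[≠] (0 : ℂ), z ≠ 0 := eventually_mem_nhdsWithin
    rw [Asymptotics.isLittleO_iff_tendsto'
      (hne.mono fun z hz h => absurd h (inv_ne_zero (by simpa using hz)))]
    have hz0 : Tendsto (fun z : ℂ => z * f 0) (𝓝[≠] 0) (𝓝 0) := by
      have : Tendsto (fun z : ℂ => z * f 0) (𝓝 0) (𝓝 (0 * f 0)) :=
        tendsto_id.mul tendsto_const_nhds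
      simpa using this.mono_left nhdsWithin_le_nhds
    have := h0.sub hz0
    rw [sub_zero] at this
    refine this.congr fun z => ?_
    rw [sub_zero, div_inv_eq_mul]; ring
  have hlim := Complex.tendsto_limUnder_of_differentiable_on_punctured_nhds_of_isLittleO hd0 ho
  rw [← hL] at hlim
  let F : ℂ → ℂ := fun z => if e z = 1 then L else f z
  have hF1 (z : ℂ) : F (z + 1) = F z := by simp only [F, e_add_one, h1]
  have hFn (z : ℂ) (n : ℤ) : F (z + n) = F z := by
    have : Function.Periodic F 1 := hF1
    simpa using this.int_mul n z
  have hF0 : DifferentiableAt ℂ F 0 := by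
    refine (Complex.analyticAt_of_differentiable_on_punctured_nhds_of_continuousAt
      ?_ ?_).differentiableAt
    · filter_upwards [eventually_e_ne_one 0, nhdsWithin_le_nhds hmem0] with z hz hzS
      refine (hd z hzS hz).congr_of_eventuallyEq ?_
      filter_upwards [isOpen_e_ne_one.mem_nhds hz] with w hw using if_neg hw
    · rw [continuousAt_iff_punctured_nhds, show F 0 = L from if_pos e_zero]
      refine hlim.congr' ?_
      filter_upwards [eventually_e_ne_one 0] with w hw using (if_neg hw).symm
  have hFd : DifferentiableOn ℂ F S := by
    intro z hz
    refine DifferentiableAt.differentiableWithinAt ?_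
    by_cases h : e z = 1
    · obtain ⟨n, rfl⟩ := (e_eq_one_iff z).1 h
      have hF : F = fun w => F (w - n) := by
        funext w
        rw [← hFn (w - n) n, sub_add_cancel]
      rw [hF]
      have : DifferentiableAt ℂ F ((n : ℂ) - n) := by rwa [sub_self]
      exact DifferentiableAt.comp (f := fun w : ℂ => w - n) (n : ℂ) this
        (differentiableAt_fun_id.sub_const _)
    · refine (hd z hz h).congr_of_eventuallyEq ?_
      filter_upwards [isOpen_e_ne_one.mem_nhds h] with w hw using if_neg hw
  have hFper (z : ℂ) (hz1 : -τ.im < z.im) (hz2 : z.im < 0) : F (z + τ) = F z := by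
    have ha : e (z + τ) ≠ 1 := e_ne_one_of_im_pos (by simp; linarith)
    have hb : e z ≠ 1 := by
      have := e_ne_one_of_im_pos (u := -z) (by simpa using hz2)
      rwa [e_neg, ne_eq, inv_eq_one] at this
    simp only [F, if_neg ha, if_neg hb, hper z hz1 hz2]
  let K : Set ℂ := Icc (0 : ℝ) 1 ×ℂ Icc (-(τ.im / 2)) (τ.im / 2)
  have hK : IsCompact K := isCompact_Icc.reProdIm isCompact_Icc
  have hKS : K ⊆ S := by
    intro z hz
    have := hz.2
    simp only [mem_preimage, mem_Icc] at this
    change |z.im| < τ.im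
    rw [abs_lt]
    constructor <;> linarith
  have hKne : K.Nonempty := ⟨0, by
    simp only [K, Complex.mem_reProdIm, mem_Icc, zero_re, zero_im]
    refine ⟨⟨le_rfl, zero_le_one⟩, ?_, ?_⟩ <;> linarith⟩
  obtain ⟨c, hcK, hc⟩ := hK.exists_isMaxOn hKne (hFd.continuousOn.mono hKS).norm
  have hred (z : ℂ) (hz : z ∈ S) (hz' : |z.im| ≤ τ.im / 2) : ‖F z‖ ≤ ‖F c‖ := by
    have hmem : z - (⌊z.re⌋ : ℤ) ∈ K := by
      simp only [K, Complex.mem_reProdIm, mem_Icc, sub_re, intCast_re, sub_im, intCast_im, sub_zero]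
      refine ⟨⟨?_, ?_⟩, abs_le.1 hz'⟩
      · linarith [Int.floor_le z.re]
      · linarith [Int.lt_floor_add_one z.re]
    have h2 : ‖F (z - (⌊z.re⌋ : ℤ))‖ ≤ ‖F c‖ := hc hmem
    rwa [← hFn (z - (⌊z.re⌋ : ℤ)) ⌊z.re⌋, sub_add_cancel] at h2
  have hmax : IsMaxOn (norm ∘ F) S c := by
    intro z hz
    obtain ⟨hz1, hz2⟩ := abs_lt.1 (show |z.im| < τ.im from hz)
    change ‖F z‖ ≤ ‖F c‖
    by_cases ha : |z.im| ≤ τ.im / 2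
    · exact hred z hz ha
    rcases lt_abs.1 (not_le.1 ha) with hb | hb
    · have him : (z - τ).im = z.im - τ.im := by simp
      rw [← sub_add_cancel z τ, hFper (z - τ) (by linarith) (by linarith)]
      have h3 : |(z - τ).im| ≤ τ.im / 2 := by rw [him, abs_le]; constructor <;> linarith
      exact hred _ (h3.trans_lt (by linarith)) h3
    · have him : (z + τ).im = z.im + τ.im := by simp
      rw [← hFper z (by linarith) (by linarith)]
      have h3 : |(z + τ).im| ≤ τ.im / 2 := by rw [him, abs_le]; constructor <;> linarith
      exact hred _ (h3.trans_lt (by linarith)) h3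
  have hSc : IsPreconnected S := by
    have : S = Complex.im ⁻¹' (Ioo (-τ.im) τ.im) := by ext z; simp [hS, abs_lt]
    rw [this]
    exact ((convex_Ioo _ _).linear_preimage Complex.imLm).isPreconnected
  have hconst := Complex.eqOn_of_isPreconnected_of_isMaxOn_norm hSc hSo hFd (hKS hcK) hmax
  have hall (z : ℂ) (hz : z ∈ S) : F z = L := by
    have ha := hconst hz
    have hb := hconst (mem_of_mem_nhds hmem0)
    simp only [Function.const_apply] at ha hb
    rw [ha, ← hb]
    exact if_pos e_zero
  refine ⟨L, hlim, fun z hz he => ?_⟩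
  rw [← hall z hz]
  exact (if_neg he).symm

/-- The regular part `∑_{a,b ≥ 1} (ζ^a - ζ^{-a}) q^{ab}` of `-J₁`. -/
def lambertOdd (τ z : ℂ) : ℂ := lambert 0 τ z - lambert 0 τ (-z)

lemma J1_eq_sub_lambertOdd {τ z : ℂ} (hz : |z.im| < τ.im) :
    J1 τ z = e z / (e z - 1) - 1 / 2 - lambertOdd τ z := J1_eq hz

lemma differentiableAt_lambert_neg (w : ℕ) {τ z : ℂ} (hz : |z.im| < τ.im) :
    DifferentiableAt ℂ (fun z => lambert w τ (-z)) z := by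
  obtain ⟨h1, h2⟩ := abs_lt.1 hz
  exact DifferentiableAt.comp z (differentiableAt_lambert w (by linarith)
    (by rw [neg_im]; linarith)) differentiableAt_fun_id.fun_neg

lemma differentiableAt_lambertOdd {τ z : ℂ} (hz : |z.im| < τ.im) :
    DifferentiableAt ℂ (lambertOdd τ) z := by
  obtain ⟨h1, h2⟩ := abs_lt.1 hz
  exact (differentiableAt_lambert 0 (by linarith) h1).sub (differentiableAt_lambert_neg 0 hz)

lemma lambertOdd_zero (τ : ℂ) : lambertOdd τ 0 = 0 := by simp [lambertOdd]

lemma hasDerivAt_lambertOdd_zero {τ : ℂ} (hτ : 0 < τ.im) :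
    HasDerivAt (lambertOdd τ) (2 * (2 * Real.pi * I * lambert 1 τ 0)) 0 := by
  have h : HasDerivAt (lambert 0 τ) (2 * Real.pi * I * lambert 1 τ 0) 0 := by
    rw [← deriv_lambert_zero hτ]
    exact (differentiableAt_lambert 0 hτ (by simpa using hτ)).hasDerivAt
  have h' : HasDerivAt (lambert 0 τ) (2 * Real.pi * I * lambert 1 τ 0) (-0) := by rwa [neg_zero]
  have h2 := h.sub (h'.comp 0 (hasDerivAt_neg (0 : ℂ)))
  exact h2.congr_deriv (by ring)

lemma hasDerivAt_J1 {τ z : ℂ} (hz : |z.im| < τ.im) (h1 : e z ≠ 1) :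
    HasDerivAt (J1 τ) (-(2 * Real.pi * I * (e z / (e z - 1) ^ 2)) - deriv (lambertOdd τ) z) z := by
  have h2 : e z - 1 ≠ 0 := sub_ne_zero.2 h1
  have h3 := (((hasDerivAt_e z).div ((hasDerivAt_e z).sub_const 1) h2).sub_const (1 / 2)).sub
    (differentiableAt_lambertOdd hz).hasDerivAt
  refine (h3.congr_of_eventuallyEq ?_).congr_deriv ?_
  · filter_upwards [(isOpen_strip τ.im).mem_nhds hz] with w hw using J1_eq_sub_lambertOdd hw
  · congr 1
    field_simp
    ring

lemma differentiableAt_J2 {τ z : ℂ} (hz : |z.im| < τ.im) : DifferentiableAt ℂ (J2 τ) z := by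
  obtain ⟨h1, h2⟩ := abs_lt.1 hz
  refine ((((differentiableAt_lambert 1 (by linarith) h1).fun_add
    (differentiableAt_lambert_neg 1 hz)).const_mul 2).const_sub (1 / 6)).congr_of_eventuallyEq ?_
  filter_upwards [(isOpen_strip τ.im).mem_nhds hz] with w hw using J2_eq hw

lemma isOpen_strip_diff (T : ℝ) : IsOpen {z : ℂ | |z.im| < T ∧ e z ≠ 1} :=
  (isOpen_strip T).inter isOpen_e_ne_one

lemma differentiableAt_deriv_J1 {τ z : ℂ} (hz : |z.im| < τ.im) (h1 : e z ≠ 1) :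
    DifferentiableAt ℂ (deriv (J1 τ)) z := by
  have h : DifferentiableOn ℂ (J1 τ) {z : ℂ | |z.im| < τ.im ∧ e z ≠ 1} := fun w hw =>
    (hasDerivAt_J1 hw.1 hw.2).differentiableAt.differentiableWithinAt
  exact (h.deriv (isOpen_strip_diff _)).differentiableAt ((isOpen_strip_diff _).mem_nhds ⟨hz, h1⟩)

lemma tendsto_mul_e_div :
    Tendsto (fun z : ℂ => z * (e z / (e z - 1) - 1 / 2)) (𝓝[≠] 0) (𝓝 (1 / (2 * Real.pi * I))) := by
  have h := (hasDerivAt_iff_tendsto_slope_zero.1 (hasDerivAt_e 0)).inv₀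
    (mul_ne_zero Complex.two_pi_I_ne_zero (e_ne_zero 0))
  have h2 : Tendsto e (𝓝[≠] 0) (𝓝 1) := by
    have := (differentiable_e.continuous.tendsto 0).mono_left (nhdsWithin_le_nhds (s := {0}ᶜ))
    rwa [e_zero] at this
  have h3 : Tendsto (fun z : ℂ => z) (𝓝[≠] 0) (𝓝 0) := tendsto_id.mono_left nhdsWithin_le_nhds
  have h4 := (h2.mul h).sub (h3.div_const 2)
  simp only [zero_add, e_zero, smul_eq_mul, mul_one, one_mul, zero_div, sub_zero] at h4
  rw [one_div (2 * (Real.pi : ℂ) * I)]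
  refine h4.congr fun z => ?_
  rw [mul_inv, inv_inv]
  ring

lemma tendsto_mul_J1 {τ : ℂ} (hτ : 0 < τ.im) :
    Tendsto (fun z : ℂ => z * J1 τ z) (𝓝[≠] 0) (𝓝 (1 / (2 * Real.pi * I))) := by
  have h0 : |(0 : ℂ).im| < τ.im := by simpa using hτ
  have h1 : Tendsto (fun z => z * lambertOdd τ z) (𝓝[≠] 0) (𝓝 0) := by
    have := (continuous_id.tendsto (0 : ℂ)).mul (differentiableAt_lambertOdd h0).continuousAt.tendsto
    simp only [id, zero_mul] at this
    exact this.mono_left nhdsWithin_le_nhds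
  have h2 := tendsto_mul_e_div.sub h1
  rw [sub_zero] at h2
  refine h2.congr' ?_
  filter_upwards [nhdsWithin_le_nhds ((isOpen_strip τ.im).mem_nhds h0)] with z hz
  rw [J1_eq_sub_lambertOdd hz]
  ring

/-- `J₂ = J₁² + D_z J₁ - E₂ / 12`. -/
lemma J2_eq_sq_add_deriv {τ z : ℂ} (hz : |z.im| < τ.im) (hz1 : e z ≠ 1) :
    J2 τ z = J1 τ z ^ 2 + 1 / (2 * Real.pi * I) * deriv (J1 τ) z - E2 τ / 12 := by
  have hτ : 0 < τ.im := (abs_nonneg _).trans_lt hz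
  have h0 : |(0 : ℂ).im| < τ.im := by simpa using hτ
  have hpi := Complex.two_pi_I_ne_zero
  set H : ℂ → ℂ := fun z => J2 τ z - J1 τ z ^ 2 - 1 / (2 * Real.pi * I) * deriv (J1 τ) z with hH
  set s := lambert 1 τ 0 with hs
  have hHeq (w : ℂ) (hw : |w.im| < τ.im) (hw1 : e w ≠ 1) :
      H w = J2 τ w - 1 / 4 + 2 * ((e w / (e w - 1) - 1 / 2) * lambertOdd τ w)
        - lambertOdd τ w ^ 2 + 1 / (2 * Real.pi * I) * deriv (lambertOdd τ) w := by
    have h2 : e w - 1 ≠ 0 := sub_ne_zero.2 hw1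
    simp only [hH]
    rw [(hasDerivAt_J1 hw hw1).deriv, J1_eq_sub_lambertOdd hw]
    have h5 : 1 / (2 * (Real.pi : ℂ) * I) * (2 * Real.pi * I * (e w / (e w - 1) ^ 2)) =
      e w / (e w - 1) ^ 2 := by field_simp
    have h6 : (e w / (e w - 1) - 1 / 2) ^ 2 - e w / (e w - 1) ^ 2 = 1 / 4 := by field_simp; ring
    linear_combination h5 - h6
  have hlimH : Tendsto H (𝓝[≠] 0) (𝓝 (-E2 τ / 12)) := by
    have hod := hasDerivAt_lambertOdd_zero hτ
    have t1 := (differentiableAt_J2 h0).continuousAt.tendsto.mono_left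
      (nhdsWithin_le_nhds (s := {0}ᶜ))
    have t2 := hod.continuousAt.tendsto.mono_left (nhdsWithin_le_nhds (s := {0}ᶜ))
    have t3 : Tendsto (deriv (lambertOdd τ)) (𝓝[≠] 0) (𝓝 (deriv (lambertOdd τ) 0)) := by
      have hh : DifferentiableOn ℂ (lambertOdd τ) {z : ℂ | |z.im| < τ.im} := fun w hw =>
        (differentiableAt_lambertOdd hw).differentiableWithinAt
      exact ((hh.deriv (isOpen_strip _)).differentiableAt
        ((isOpen_strip _).mem_nhds h0)).continuousAt.tendsto.mono_left nhdsWithin_le_nhds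
    have t4 := tendsto_mul_e_div.mul (hasDerivAt_iff_tendsto_slope_zero.1 hod)
    have t := (((t1.sub_const (1 / 4)).add (t4.const_mul 2)).sub (t2.pow 2)).add
      (t3.const_mul (1 / (2 * Real.pi * I)))
    have hval : J2 τ 0 - 1 / 4 + 2 * (1 / (2 * Real.pi * I) * (2 * (2 * Real.pi * I * s)))
        - lambertOdd τ 0 ^ 2 + 1 / (2 * Real.pi * I) * deriv (lambertOdd τ) 0 = -E2 τ / 12 := by
      rw [J2_eq h0, hod.deriv, lambertOdd_zero, E2_eq hτ, neg_zero, ← hs]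
      field_simp
      ring
    rw [hval] at t
    refine t.congr' ?_
    filter_upwards [eventually_e_ne_one 0, nhdsWithin_le_nhds ((isOpen_strip τ.im).mem_nhds h0),
      eventually_mem_nhdsWithin] with w hw1 hw hw0
    have hw0 : w ≠ 0 := hw0
    rw [hHeq w hw hw1, zero_add, lambertOdd_zero, sub_zero, smul_eq_mul]
    field_simp
  have key : ∃ C, Tendsto H (𝓝[≠] 0) (𝓝 C) ∧ ∀ z, |z.im| < τ.im → e z ≠ 1 → H z = C := by
    refine exists_eq_const_of_doubly_periodic hτ ?_ ?_ ?_ ?_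
    · intro w hw hw1
      exact ((differentiableAt_J2 hw).sub ((hasDerivAt_J1 hw hw1).differentiableAt.pow 2)).sub
        ((differentiableAt_deriv_J1 hw hw1).const_mul _)
    · intro w
      have h1 : deriv (J1 τ) (w + 1) = deriv (J1 τ) w := by
        rw [← deriv_comp_add_const (J1 τ) 1 w]
        simp only [J1_add_one]
      simp only [hH, J1_add_one, J2_add_one, h1]
    · intro w hw1 hw2
      have h1 : deriv (J1 τ) (w + τ) = deriv (J1 τ) w := by
        rw [← deriv_comp_add_const (J1 τ) τ w, ← deriv_sub_const (f := J1 τ) (1 : ℂ)]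
        refine EventuallyEq.deriv_eq ?_
        have ho : IsOpen {z : ℂ | -τ.im < z.im ∧ z.im < 0} :=
          (Complex.isOpen_im_gt _).inter (Complex.isOpen_im_lt _)
        filter_upwards [ho.mem_nhds ⟨hw1, hw2⟩] with v hv using J1_add_self hv.1 hv.2
      simp only [hH, h1, J1_add_self hw1 hw2, J2_add_self hw1 hw2]
      ring
    · have h3 : Tendsto (fun z : ℂ => z) (𝓝[≠] 0) (𝓝 0) := tendsto_id.mono_left nhdsWithin_le_nhds
      simpa using h3.mul hlimH
  obtain ⟨C, hC, hC'⟩ := key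
  have h1 := hC' z hz hz1
  rw [tendsto_nhds_unique hC hlimH] at h1
  simp only [hH] at h1
  linear_combination h1

/-- The quasi-periodic continuation of `J₁ τ` to the whole plane. -/
def J1ext (τ z : ℂ) : ℂ :=
  J1 τ (z - (round (z.im / τ.im) : ℤ) * τ) - (round (z.im / τ.im) : ℤ)

lemma J1_add_intCast (τ z : ℂ) (n : ℤ) : J1 τ (z + n) = J1 τ z := by
  have : Function.Periodic (J1 τ) 1 := J1_add_one τ
  simpa using this.int_mul n z

lemma J1ext_add_lattice {τ : ℂ} (hτ : 0 < τ.im) (z : ℂ) (r n : ℤ) :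
    J1ext τ (z + r * τ + n) = J1ext τ z - r := by
  have h : (z + r * τ + n).im / τ.im = z.im / τ.im + r := by
    simp only [add_im, mul_im, intCast_re, intCast_im, zero_mul, add_zero]
    field_simp
  have h2 : z + r * τ + n - ((round (z.im / τ.im) : ℂ) + r) * τ =
    z - (round (z.im / τ.im) : ℂ) * τ + n := by ring
  rw [J1ext, h, round_add_intCast, Int.cast_add, h2, J1_add_intCast, J1ext]
  ring

lemma abs_im_sub_round_lt {τ : ℂ} (hτ : 0 < τ.im) (z : ℂ) :
    |(z - (round (z.im / τ.im) : ℤ) * τ).im| < τ.im := by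
  have h : (z - (round (z.im / τ.im) : ℤ) * τ).im =
      (z.im / τ.im - round (z.im / τ.im)) * τ.im := by
    simp only [sub_im, mul_im, intCast_re, intCast_im, zero_mul, add_zero]
    field_simp
  rw [h, abs_mul, abs_of_pos hτ]
  nlinarith [abs_sub_round (z.im / τ.im)]

lemma J1ext_eq {τ z : ℂ} (hz : |z.im| < τ.im) : J1ext τ z = J1 τ z := by
  have hτ : 0 < τ.im := (abs_nonneg _).trans_lt hz
  have h := abs_im_sub_round_lt hτ z
  obtain ⟨h1, h2⟩ := abs_lt.1 hz
  rw [J1ext]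
  generalize round (z.im / τ.im) = r at *
  have him : (z - r * τ).im = z.im - r * τ.im := by simp
  rw [him, abs_lt] at h
  have hr1 : r < 2 := by
    have : (r : ℝ) < 2 := by by_contra! hh; nlinarith
    exact_mod_cast this
  have hr2 : -2 < r := by
    have : (-2 : ℝ) < r := by by_contra! hh; nlinarith
    exact_mod_cast this
  obtain rfl | rfl | rfl : r = -1 ∨ r = 0 ∨ r = 1 := by omega
  · push_cast at *
    rw [show z - -1 * τ = z + τ by ring, J1_add_self h1 (by linarith)]
    ring
  · simp
  · push_cast at *
    have := J1_add_self (τ := τ) (z := z - τ) (by simp; linarith) (by simp; linarith)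
    rw [sub_add_cancel] at this
    rw [this, one_mul]

lemma J1ext_eq_sub {τ z : ℂ} (r : ℤ) (hz : |(z - r * τ).im| < τ.im) :
    J1ext τ z = J1 τ (z - r * τ) - r := by
  have h := J1ext_add_lattice ((abs_nonneg _).trans_lt hz) (z - r * τ) r 0
  rw [← J1ext_eq hz, ← h]
  simp

lemma J1ext_neg {τ z : ℂ} (hτ : 0 < τ.im) (hz : ∀ r : ℤ, e (z - r * τ) ≠ 1) :
    J1ext τ (-z) = -J1ext τ z := by
  have h := abs_im_sub_round_lt hτ z
  set r := round (z.im / τ.im)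
  have h2 : -z - (-r : ℤ) * τ = -(z - r * τ) := by push_cast; ring
  rw [J1ext_eq_sub r h, J1ext_eq_sub (-r) (by rwa [h2, neg_im, abs_neg]), h2, J1_neg h (hz r)]
  push_cast
  ring

lemma differentiableAt_J1ext {τ z : ℂ} (hτ : 0 < τ.im) (hz : ∀ r : ℤ, e (z - r * τ) ≠ 1) :
    DifferentiableAt ℂ (J1ext τ) z := by
  have h := abs_im_sub_round_lt hτ z
  set r := round (z.im / τ.im)
  have h1 : DifferentiableAt ℂ (fun w => J1 τ (w - r * τ)) z :=
    DifferentiableAt.comp (f := fun w : ℂ => w - r * τ) z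
      (hasDerivAt_J1 h (hz r)).differentiableAt (differentiableAt_fun_id.sub_const _)
  refine (h1.sub_const (r : ℂ)).congr_of_eventuallyEq ?_
  have ho : IsOpen {w : ℂ | |(w - r * τ).im| < τ.im} :=
    (isOpen_strip τ.im).preimage (continuous_id.sub continuous_const)
  filter_upwards [ho.mem_nhds h] with w hw using J1ext_eq_sub r hw

lemma tendsto_mul_J1ext {τ : ℂ} (hτ : 0 < τ.im) :
    Tendsto (fun z : ℂ => z * J1ext τ z) (𝓝[≠] 0) (𝓝 (1 / (2 * Real.pi * I))) := by
  refine (tendsto_mul_J1 hτ).congr' ?_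
  filter_upwards [nhdsWithin_le_nhds ((isOpen_strip τ.im).mem_nhds
    (show |(0 : ℂ).im| < τ.im by simpa using hτ))] with z hz
  rw [J1ext_eq hz]

lemma e_sub_int_mul_ne_one {τ z : ℂ} (hz : |z.im| < τ.im) (h1 : e z ≠ 1) (r : ℤ) :
    e (z - r * τ) ≠ 1 := by
  intro h
  obtain ⟨n, hn⟩ := (e_eq_one_iff _).1 h
  have hτ : 0 < τ.im := (abs_nonneg _).trans_lt hz
  have him : z.im = r * τ.im := by
    have := congrArg Complex.im hn
    simp only [sub_im, mul_im, intCast_re, intCast_im, zero_mul, add_zero] at this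
    linarith
  rw [him, abs_mul, abs_of_pos hτ, mul_lt_iff_lt_one_left hτ] at hz
  have : r = 0 := Int.abs_lt_one_iff.1 (by exact_mod_cast hz)
  rw [this, Int.cast_zero, zero_mul, sub_zero] at h
  exact h1 h

lemma J1ext_transform {a b c d : ℤ} (hdet : a * d - b * c = 1) {τ z : ℂ}
    (hj : (c : ℂ) * τ + d ≠ 0) (hτ' : 0 < (((a : ℂ) * τ + b) / (c * τ + d)).im)
    (hz : |z.im| < τ.im) (h1 : e z ≠ 1) :
    J1ext (((a : ℂ) * τ + b) / (c * τ + d)) (z / (c * τ + d)) =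
      (c * τ + d) * J1 τ z + c * z := by
  have hτ : 0 < τ.im := (abs_nonneg _).trans_lt hz
  have hdet' : (a : ℂ) * d - b * c = 1 := by exact_mod_cast hdet
  set j := (c : ℂ) * τ + d with hjdef
  set τ' := ((a : ℂ) * τ + b) / j with hτ'def
  have hone : 1 / j = (-c : ℤ) * τ' + (a : ℤ) := by
    rw [hτ'def]; push_cast; field_simp; rw [hjdef]; linear_combination -hdet'
  have htau : τ / j = (d : ℤ) * τ' + (-b : ℤ) := by
    rw [hτ'def]; push_cast; field_simp; rw [hjdef]; linear_combination -τ * hdet'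
  have hlat (w : ℂ) (hw : |w.im| < τ.im) (hw1 : e w ≠ 1) (r : ℤ) : e (w / j - r * τ') ≠ 1 := by
    intro h
    obtain ⟨n, hn⟩ := (e_eq_one_iff _).1 h
    refine e_sub_int_mul_ne_one hw hw1 (r * a + n * c) ((e_eq_one_iff _).2 ⟨r * b + n * d, ?_⟩)
    have : w = (n + r * τ') * j := by rw [← hn]; field_simp; ring
    rw [this, hτ'def]
    push_cast
    field_simp
    rw [hjdef]
    ring
  set G : ℂ → ℂ := fun w => J1ext τ' (w / j) - j * J1ext τ w - c * w with hG
  have key : ∃ C, Tendsto G (𝓝[≠] 0) (𝓝 C) ∧ ∀ z, |z.im| < τ.im → e z ≠ 1 → G z = C := by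
    refine exists_eq_const_of_doubly_periodic hτ ?_ ?_ ?_ ?_
    · intro w hw hw1
      have hd : DifferentiableAt ℂ (fun w => J1ext τ' (w / j)) w :=
        DifferentiableAt.comp (f := fun w : ℂ => w / j) w
          (differentiableAt_J1ext hτ' (hlat w hw hw1)) (differentiableAt_fun_id.div_const _)
      exact (hd.sub ((differentiableAt_J1ext hτ (e_sub_int_mul_ne_one hw hw1)).const_mul _)).sub
        (differentiableAt_fun_id.const_mul _)
    · intro w
      have h2 : (w + 1) / j = w / j + (-c : ℤ) * τ' + (a : ℤ) := by
        rw [add_div, hone, add_assoc]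
      have h3 : w + 1 = w + (0 : ℤ) * τ + (1 : ℤ) := by simp
      simp only [hG, h2, J1ext_add_lattice hτ']
      rw [h3, J1ext_add_lattice hτ]
      push_cast
      ring
    · intro w _ _
      have h2 : (w + τ) / j = w / j + (d : ℤ) * τ' + (-b : ℤ) := by
        rw [add_div, htau, add_assoc]
      have h3 : w + τ = w + (1 : ℤ) * τ + (0 : ℤ) := by simp
      simp only [hG, h2, J1ext_add_lattice hτ']
      rw [h3, J1ext_add_lattice hτ]
      push_cast
      linear_combination hjdef
    · have t0 : Tendsto (fun z : ℂ => z) (𝓝[≠] 0) (𝓝 0) := tendsto_id.mono_left nhdsWithin_le_nhds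
      have tj : Tendsto (fun z : ℂ => z / j) (𝓝[≠] 0) (𝓝[≠] 0) := by
        refine tendsto_nhdsWithin_iff.2 ⟨by simpa using t0.div_const j, ?_⟩
        filter_upwards [eventually_mem_nhdsWithin] with w hw
        exact div_ne_zero hw hj
      have t := ((((tendsto_mul_J1ext hτ').comp tj).const_mul j).sub
        ((tendsto_mul_J1ext hτ).const_mul j)).sub (((t0.pow 2)).const_mul (c : ℂ))
      have h0 : j * (1 / (2 * Real.pi * I)) - j * (1 / (2 * Real.pi * I)) - c * 0 ^ 2 = 0 := by ring
      rw [h0] at t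
      refine t.congr fun w => ?_
      simp only [hG, Function.comp]
      field_simp
  obtain ⟨C, -, hC⟩ := key
  have h2 := hC z hz h1
  have h3 := hC (-z) (by simpa using hz) (by rwa [e_neg, ne_eq, inv_eq_one])
  simp only [hG] at h2 h3
  rw [neg_div, J1ext_neg hτ' (hlat z hz h1), J1ext_neg hτ (e_sub_int_mul_ne_one hz h1)] at h3
  rw [J1ext_eq hz] at h2 h3
  linear_combination (h2 - h3) / 2

/-- `J₁` is quasi-modular of weight one under the Jacobi group. -/
lemma J1_transform {a b c d lam mu : ℤ} (hdet : a * d - b * c = 1) {τ z : ℂ}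
    (hj : (c : ℂ) * τ + d ≠ 0) (hz : |z.im| < τ.im) (h1 : e z ≠ 1)
    (hz' : |((z + lam * τ + mu) / (c * τ + d)).im| < (((a : ℂ) * τ + b) / (c * τ + d)).im) :
    J1 (((a : ℂ) * τ + b) / (c * τ + d)) ((z + lam * τ + mu) / (c * τ + d)) =
      (c * τ + d) * J1 τ z + c * (z + lam * τ + mu) - lam * (c * τ + d) := by
  have hdet' : (a : ℂ) * d - b * c = 1 := by exact_mod_cast hdet
  have hτ' := (abs_nonneg _).trans_lt hz'
  have h2 : (z + lam * τ + mu) / (c * τ + d) = z / (c * τ + d) +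
      (lam * d - mu * c : ℤ) * (((a : ℂ) * τ + b) / (c * τ + d)) + (mu * a - lam * b : ℤ) := by
    push_cast
    generalize hjd : (c : ℂ) * τ + d = j at hj
    field_simp
    linear_combination -(lam * τ + mu) * hdet' + (mu * a - lam * b) * hjd
  rw [← J1ext_eq hz', h2, J1ext_add_lattice hτ', J1ext_transform hdet hj hτ' hz h1]
  push_cast
  ring

lemma deriv_J1_transform {a b c d lam mu : ℤ} (hdet : a * d - b * c = 1) {τ z : ℂ}
    (hj : (c : ℂ) * τ + d ≠ 0) (hz : |z.im| < τ.im) (h1 : e z ≠ 1)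
    (hz' : |((z + lam * τ + mu) / (c * τ + d)).im| < (((a : ℂ) * τ + b) / (c * τ + d)).im)
    (h1' : e ((z + lam * τ + mu) / (c * τ + d)) ≠ 1) :
    deriv (J1 (((a : ℂ) * τ + b) / (c * τ + d))) ((z + lam * τ + mu) / (c * τ + d)) =
      (c * τ + d) ^ 2 * deriv (J1 τ) z + c * (c * τ + d) := by
  have hA : HasDerivAt (fun w : ℂ => (w + lam * τ + mu) / (c * τ + d)) (1 / (c * τ + d)) z :=
    (((hasDerivAt_id z).add_const (lam * τ : ℂ)).add_const (mu : ℂ)).div_const _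
  have h2 := (hasDerivAt_J1 hz' h1').differentiableAt.hasDerivAt.comp z hA
  have h3 : HasDerivAt (fun w => (c * τ + d) * J1 τ w + c * (w + lam * τ + mu) -
      lam * (c * τ + d)) ((c * τ + d) * deriv (J1 τ) z + c * 1) z :=
    (((hasDerivAt_J1 hz h1).differentiableAt.hasDerivAt.const_mul _).add
      ((((hasDerivAt_id z).add_const (lam * τ : ℂ)).add_const (mu : ℂ)).const_mul _)).sub_const _
  have h4 := h2.unique (h3.congr_of_eventuallyEq ?_)
  · rw [mul_one_div, div_eq_iff hj] at h4
    linear_combination h4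
  · have ho := (isOpen_strip (((a : ℂ) * τ + b) / (c * τ + d)).im).preimage
      (f := fun w : ℂ => (w + lam * τ + mu) / (c * τ + d)) (by fun_prop)
    filter_upwards [ho.mem_nhds hz', (isOpen_strip_diff τ.im).mem_nhds ⟨hz, h1⟩] with w hw hw'
    exact J1_transform hdet hj hw'.1 hw'.2 hw

lemma J2_transform {a b c d lam mu : ℤ} (hdet : a * d - b * c = 1) {τ z : ℂ}
    (hj : (c : ℂ) * τ + d ≠ 0) (hz : |z.im| < τ.im) (h1 : e z ≠ 1)
    (hz' : |((z + lam * τ + mu) / (c * τ + d)).im| < (((a : ℂ) * τ + b) / (c * τ + d)).im)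
    (h1' : e ((z + lam * τ + mu) / (c * τ + d)) ≠ 1) :
    J2 (((a : ℂ) * τ + b) / (c * τ + d)) ((z + lam * τ + mu) / (c * τ + d)) =
      (c * τ + d) ^ 2 * J2 τ z +
        2 * (c * τ + d) * (c * (z + lam * τ + mu) - lam * (c * τ + d)) * J1 τ z +
        (c * (z + lam * τ + mu) - lam * (c * τ + d)) ^ 2 := by
  rw [J2_eq_sq_add_deriv hz' h1', J2_eq_sq_add_deriv hz h1, deriv_J1_transform hdet hj hz h1 hz' h1',
    J1_transform hdet hj hz h1 hz', E2_transform hdet ((abs_nonneg _).trans_lt hz)]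
  field_simp
  ring

lemma hasDerivAt_Qmon_left (n : ℕ) (r : ℤ) (τ z : ℂ) :
    HasDerivAt (fun t => Qmon n r t z) (2 * Real.pi * I * (n * Qmon n r τ z)) τ := by
  have h : HasDerivAt (fun t : ℂ => (n : ℂ) * t + r * z) ((n : ℂ) * 1) τ :=
    ((hasDerivAt_id τ).const_mul _).add_const _
  refine ((hasDerivAt_e _).comp τ h).congr_deriv ?_
  rw [Qmon]
  ring

lemma hasDerivAt_Qmon_right (n : ℕ) (r : ℤ) (τ z : ℂ) :
    HasDerivAt (fun w => Qmon n r τ w) (2 * Real.pi * I * (r * Qmon n r τ z)) z := by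
  have h : HasDerivAt (fun w : ℂ => (n : ℂ) * τ + r * w) ((r : ℂ) * 1) z :=
    ((hasDerivAt_id z).const_mul _).const_add _
  refine ((hasDerivAt_e _).comp z h).congr_deriv ?_
  rw [Qmon]
  ring

lemma Dt_eq_of_hasDerivAt {φ : ℂ → ℂ → ℂ} {τ z φ' : ℂ}
    (h : HasDerivAt (fun t => φ t z) (2 * Real.pi * I * φ') τ) : Dt φ τ z = φ' := by
  rw [Dt, h.deriv]
  field_simp

lemma Dz_eq_of_hasDerivAt {φ : ℂ → ℂ → ℂ} {τ z φ' : ℂ}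
    (h : HasDerivAt (fun w => φ τ w) (2 * Real.pi * I * φ') z) : Dz φ τ z = φ' := by
  rw [Dz, h.deriv]
  field_simp

lemma Dt_Qmon (n : ℕ) (r : ℤ) (τ z : ℂ) : Dt (Qmon n r) τ z = n * Qmon n r τ z :=
  Dt_eq_of_hasDerivAt (hasDerivAt_Qmon_left n r τ z)

lemma Dz_Qmon (n : ℕ) (r : ℤ) (τ z : ℂ) : Dz (Qmon n r) τ z = r * Qmon n r τ z :=
  Dz_eq_of_hasDerivAt (hasDerivAt_Qmon_right n r τ z)

lemma Dz_Dz_Qmon (n : ℕ) (r : ℤ) (τ z : ℂ) :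
    Dz (Dz (Qmon n r)) τ z = r ^ 2 * Qmon n r τ z := by
  refine Dz_eq_of_hasDerivAt ?_
  simp only [Dz_Qmon]
  exact ((hasDerivAt_Qmon_right n r τ z).const_mul (r : ℂ)).congr_deriv (by ring)

/-- The slash action on a monomial, as an automorphy factor times a single exponential. -/
lemma slash_Qmon (k : ℤ) (m n : ℕ) (a b c d lam mu r : ℤ) (τ z : ℂ) :
    slash k m a b c d lam mu (Qmon n r) τ z = ((c : ℂ) * τ + d) ^ (-k) *
      e (m * (-c * (z + lam * τ + mu) ^ 2 / (c * τ + d) + lam ^ 2 * τ + 2 * lam * z) +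
        (n * ((a * τ + b) / (c * τ + d)) + r * ((z + lam * τ + mu) / (c * τ + d)))) := by
  rw [slash, Qmon, mul_assoc, ← e_add, Int.cast_natCast]

lemma hasDerivAt_slash_Qmon_right (k : ℤ) (m n : ℕ) (a b c d lam mu r : ℤ) (τ z : ℂ) :
    HasDerivAt (fun w => slash k m a b c d lam mu (Qmon n r) τ w)
      (2 * Real.pi * I * ((2 * m * (lam - c * (z + lam * τ + mu) / (c * τ + d)) + r / (c * τ + d)) *
        slash k m a b c d lam mu (Qmon n r) τ z)) z := by
  simp only [slash_Qmon]
  have h0 : HasDerivAt (fun w : ℂ => w + lam * τ + mu) 1 z :=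
    ((hasDerivAt_id z).add_const (lam * τ : ℂ)).add_const (mu : ℂ)
  have h1 := ((((((h0.fun_pow 2).const_mul (-c : ℂ)).div_const (c * τ + d)).add_const
    ((lam : ℂ) ^ 2 * τ)).fun_add ((hasDerivAt_id z).const_mul (2 * lam : ℂ))).const_mul
    (m : ℂ)).fun_add (((h0.div_const (c * τ + d)).const_mul (r : ℂ)).const_add
      (n * ((a * τ + b) / (c * τ + d)) : ℂ))
  refine (((hasDerivAt_e _).comp z h1).const_mul (((c : ℂ) * τ + d) ^ (-k))).congr_deriv ?_
  simp only [id]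
  ring

lemma Dz_slash_Qmon (k : ℤ) (m n : ℕ) (a b c d lam mu r : ℤ) (τ z : ℂ) :
    Dz (slash k m a b c d lam mu (Qmon n r)) τ z =
      (2 * m * (lam - c * (z + lam * τ + mu) / (c * τ + d)) + r / (c * τ + d)) *
        slash k m a b c d lam mu (Qmon n r) τ z :=
  Dz_eq_of_hasDerivAt (hasDerivAt_slash_Qmon_right k m n a b c d lam mu r τ z)

lemma Dz_Dz_slash_Qmon (k : ℤ) (m n : ℕ) (a b c d lam mu r : ℤ) (τ z : ℂ) :
    Dz (Dz (slash k m a b c d lam mu (Qmon n r))) τ z =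
      ((2 * m * (lam - c * (z + lam * τ + mu) / (c * τ + d)) + r / (c * τ + d)) ^ 2 -
        2 * m * c / (c * τ + d) / (2 * Real.pi * I)) *
        slash k m a b c d lam mu (Qmon n r) τ z := by
  refine Dz_eq_of_hasDerivAt ?_
  simp only [Dz_slash_Qmon]
  have h0 : HasDerivAt (fun w : ℂ => w + lam * τ + mu) 1 z :=
    ((hasDerivAt_id z).add_const (lam * τ : ℂ)).add_const (mu : ℂ)
  have h1 := ((((h0.const_mul (c : ℂ)).div_const (c * τ + d)).const_sub (lam : ℂ)).const_mul
    (2 * m : ℂ)).add_const (r / (c * τ + d) : ℂ)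
  refine (h1.fun_mul (hasDerivAt_slash_Qmon_right k m n a b c d lam mu r τ z)).congr_deriv ?_
  generalize slash k m a b c d lam mu (Qmon n r) τ z = s
  have hpi := Complex.two_pi_I_ne_zero
  generalize 2 * (Real.pi : ℂ) * I = p at *
  field_simp
  ring

lemma Dt_slash_Qmon (k : ℤ) (m n : ℕ) {a b c d : ℤ} (hdet : a * d - b * c = 1) (lam mu r : ℤ)
    {τ : ℂ} (hj : (c : ℂ) * τ + d ≠ 0) (z : ℂ) :
    Dt (slash k m a b c d lam mu (Qmon n r)) τ z =
      (-(k * c) / (c * τ + d) / (2 * Real.pi * I) +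
        m * (lam - c * (z + lam * τ + mu) / (c * τ + d)) ^ 2 + n / (c * τ + d) ^ 2 +
        r / (c * τ + d) * (lam - c * (z + lam * τ + mu) / (c * τ + d))) *
        slash k m a b c d lam mu (Qmon n r) τ z := by
  refine Dt_eq_of_hasDerivAt ?_
  simp only [slash_Qmon]
  have hdet' : (a : ℂ) * d - b * c = 1 := by exact_mod_cast hdet
  have hj1 : HasDerivAt (fun t : ℂ => (c : ℂ) * t + d) (c * 1) τ :=
    ((hasDerivAt_id τ).const_mul _).add_const _
  have ha1 : HasDerivAt (fun t : ℂ => (a : ℂ) * t + b) (a * 1) τ :=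
    ((hasDerivAt_id τ).const_mul _).add_const _
  have h0 : HasDerivAt (fun t : ℂ => z + lam * t + mu) (lam * 1) τ :=
    (((hasDerivAt_id τ).const_mul (lam : ℂ)).const_add z).add_const (mu : ℂ)
  have h1 := ((((((h0.fun_pow 2).const_mul (-c : ℂ)).fun_div hj1 hj).fun_add
    ((hasDerivAt_id τ).const_mul ((lam : ℂ) ^ 2))).add_const (2 * lam * z : ℂ)).const_mul
    (m : ℂ)).fun_add (((ha1.fun_div hj1 hj).const_mul (n : ℂ)).fun_add
      ((h0.fun_div hj1 hj).const_mul (r : ℂ)))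
  have h2 : HasDerivAt (fun t : ℂ => ((c : ℂ) * t + d) ^ (-k)) _ τ :=
    HasDerivAt.comp (h₂ := fun x : ℂ => x ^ (-k)) τ (hasDerivAt_zpow (-k) _ (Or.inl hj)) hj1
  refine (h2.fun_mul ((hasDerivAt_e _).comp τ h1)).congr_deriv ?_
  simp only [id, Function.comp]
  generalize e _ = s
  have hpi := Complex.two_pi_I_ne_zero
  generalize 2 * (Real.pi : ℂ) * I = p at *
  rw [zpow_sub_one₀ hj]
  generalize hJ : ((c : ℂ) * τ + d) ^ (-k) = J
  generalize hjd : (c : ℂ) * τ + d = j at hj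
  push_cast
  field_simp
  have h5 : (a : ℂ) * j - c * (a * τ + b) = 1 := by rw [← hjd]; linear_combination hdet'
  linear_combination J * s * p * n * h5

/-- the Jacobi–Serre derivative commutes with the slash action on monomials,
on points of `D'` whose image also lies in `D'`. -/
theorem statement3 (k m n : ℕ) (hk : 0 < k) (hm : 0 < m) (hn : 0 < n) (r : ℤ)
    (a b c d lam mu : ℤ) (hdet : a * d - b * c = 1) (τ z : ℂ)
    (hmem : (τ, z) ∈ D')
    (hmem' : (((a : ℂ) * τ + (b : ℂ)) / ((c : ℂ) * τ + (d : ℂ)),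
      (z + (lam : ℂ) * τ + (mu : ℂ)) / ((c : ℂ) * τ + (d : ℂ))) ∈ D') :
    JSerre k m (slash (k : ℤ) (m : ℤ) a b c d lam mu (Qmon n r)) τ z
      = slash ((k : ℤ) + 2) (m : ℤ) a b c d lam mu (JSerre k m (Qmon n r)) τ z := by

  obtain ⟨hτ, hz, h1⟩ := hmem
  obtain ⟨hτ', hz', h1'⟩ := hmem'
  simp only at hτ hz h1 hτ' hz' h1'
  have hj : (c : ℂ) * τ + d ≠ 0 := by
    intro h
    simp [h] at hτ'
  have hm4 : (1 : ℂ) - 4 * m ≠ 0 := by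
    have h : (1 : ℤ) - 4 * m ≠ 0 := by omega
    exact_mod_cast h
  have hzp : ((c : ℂ) * τ + d) ^ (-((k : ℤ) + 2)) =
      (c * τ + d) ^ (-(k : ℤ)) / (c * τ + d) ^ 2 := by
    rw [show -((k : ℤ) + 2) = -(k : ℤ) - (2 : ℕ) by push_cast; ring, zpow_sub₀ hj, zpow_natCast]
  have hQ : Qmon n r ((a * τ + b) / (c * τ + d)) ((z + lam * τ + mu) / (c * τ + d)) ≠ 0 :=
    e_ne_zero _
  have hs : slash ((k : ℤ) + 2) m a b c d lam mu (JSerre k m (Qmon n r)) τ z =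
      JSerre k m (Qmon n r) ((a * τ + b) / (c * τ + d)) ((z + lam * τ + mu) / (c * τ + d)) /
        Qmon n r ((a * τ + b) / (c * τ + d)) ((z + lam * τ + mu) / (c * τ + d)) /
        (c * τ + d) ^ 2 * slash k m a b c d lam mu (Qmon n r) τ z := by
    rw [slash, slash, hzp]
    generalize Qmon n r _ _ = Q at hQ ⊢
    field_simp
  rw [hs]
  simp only [JSerre, Dt_Qmon, Dz_Dz_Qmon, Dz_Qmon, Dz_slash_Qmon, Dz_Dz_slash_Qmon,
    Dt_slash_Qmon k m n hdet lam mu r hj, J1_transform hdet hj hz h1 hz',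
    J2_transform hdet hj hz h1 hz' h1', E2_transform hdet hτ]
  generalize slash k m a b c d lam mu (Qmon n r) τ z = s
  generalize Qmon n r _ _ = Q at hQ ⊢
  have hpi := Complex.two_pi_I_ne_zero
  generalize 2 * (Real.pi : ℂ) * I = p at *
  generalize (c : ℂ) * τ + d = j at hj
  generalize z + lam * τ + mu = u
  rw [Int.cast_natCast]
  generalize hN : (1 : ℂ) - 4 * m = N at hm4 ⊢
  have hmN : (m : ℂ) = (1 - N) / 4 := by rw [← hN]; ring
  rw [hmN]
  field_simp
  ring
end
end

section
/- Let m, n, ℓ be positive integers, let r, w be integers with 4nm − r² > 0 and 4ℓm − w² > 0, and let k be a positive integer. Writing τ = u+iv and z = x+iy, the integral I = ∫_{u∈[0,1]} ∫_{v∈(0,∞)} ∫_{x∈[0,1]} ∫_{y∈ℝ} e^{2πi(nτ+rz)} · conj(e^{2πi(ℓτ+wz)}) · v^{k+2} e^{−4πmy²/v} · (du dv dx dy)/v³ converges absolutely, and I = m^k Γ(k+1/2) / (2 π^{k+1/2} (4ℓm − w²)^{k+1/2}) if n = ℓ and r = w, while I = 0 otherwise. -/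
noncomputable section

open Complex MeasureTheory Set
open scoped ComplexConjugate

/-- The integrand of STATEMENT 4, as a function of `(u, v, x, y)` with `τ = u + iv`,
`z = x + iy`. -/
def F4 (k m n ℓ : ℕ) (r w : ℤ) (p : ℝ × ℝ × ℝ × ℝ) : ℂ :=
  Qmon n r ⟨p.1, p.2.1⟩ ⟨p.2.2.1, p.2.2.2⟩ *
    conj (Qmon ℓ w ⟨p.1, p.2.1⟩ ⟨p.2.2.1, p.2.2.2⟩) *
    (p.2.1 : ℂ) ^ (k + 2) * Real.exp (-4 * Real.pi * m * p.2.2.2 ^ 2 / p.2.1) /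
    (p.2.1 : ℂ) ^ 3

/-- The modulus of the integrand `F4`, as a function of `(v, y)`, with `a = n + ℓ` and
`s = r + w`. -/
def radialKernel (k : ℕ) (m a s v y : ℝ) : ℝ :=
  Real.exp (-2 * Real.pi * (a * v + s * y)) * v ^ (k + 2) *
    Real.exp (-4 * Real.pi * m * y ^ 2 / v) / v ^ 3

theorem F4_eq (k m n ℓ : ℕ) (r w : ℤ) (u v x y : ℝ) :
    F4 k m n ℓ r w (u, v, x, y) =
      e (((n - ℓ : ℤ) : ℂ) * u) *
        (e (((r - w : ℤ) : ℂ) * x) * (radialKernel k m (n + ℓ) (r + w) v y : ℂ)) := by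
  have hexp : Qmon n r ⟨u, v⟩ ⟨x, y⟩ * conj (Qmon ℓ w ⟨u, v⟩ ⟨x, y⟩) =
      e (((n - ℓ : ℤ) : ℂ) * u) * (e (((r - w : ℤ) : ℂ) * x) *
        (Real.exp (-2 * Real.pi * ((n + ℓ) * v + (r + w) * y)) : ℂ)) := by
    simp only [Qmon, e, ← Complex.exp_conj, Complex.ofReal_exp, ← Complex.exp_add]
    congr 1
    apply Complex.ext <;> simp <;> ring
  simp only [F4, radialKernel, hexp]
  push_cast
  ring

theorem norm_e_ofReal (j : ℤ) (t : ℝ) : ‖e ((j : ℂ) * t)‖ = 1 := by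
  rw [e, show 2 * (Real.pi : ℂ) * Complex.I * (j * t) = ((2 * Real.pi * (j * t) : ℝ) : ℂ) * I by
    push_cast; ring]
  exact Complex.norm_exp_ofReal_mul_I _

theorem continuous_e_ofReal (j : ℤ) : Continuous fun t : ℝ => e ((j : ℂ) * t) := by
  unfold e
  fun_prop

theorem integrableOn_e_ofReal (j : ℤ) :
    IntegrableOn (fun t : ℝ => e ((j : ℂ) * t)) (Icc 0 1) :=
  (continuous_e_ofReal j).continuousOn.integrableOn_Icc

theorem integral_e_ofReal (j : ℤ) :
    ∫ t : ℝ in Icc 0 1, e ((j : ℂ) * t) = if j = 0 then 1 else 0 := by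
  split_ifs with hj
  · simp [hj, e]
  · have hc : 2 * (Real.pi : ℂ) * Complex.I * j ≠ 0 := by
      simp [Real.pi_ne_zero, hj]
    rw [integral_Icc_eq_integral_Ioc, ← intervalIntegral.integral_of_le zero_le_one]
    simp only [e, ← mul_assoc]
    rw [integral_exp_mul_complex hc]
    have h1 : Complex.exp (2 * Real.pi * Complex.I * j) = 1 :=
      Complex.exp_eq_one_iff.mpr ⟨j, by ring⟩
    simp [h1]

section RadialKernel

variable {k : ℕ} {m a s : ℝ}

theorem radialKernel_eq (hm : 0 < m) {v : ℝ} (hv : 0 < v) (y : ℝ) :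
    radialKernel k m a s v y =
      v ^ (k + 2) / v ^ 3 * Real.exp (-((2 * Real.pi * a - Real.pi * s ^ 2 / (4 * m)) * v)) *
        Real.exp (-(4 * Real.pi * m / v) * (y + s * v / (4 * m)) ^ 2) := by
  have h : Real.exp (-2 * Real.pi * (a * v + s * y)) * Real.exp (-4 * Real.pi * m * y ^ 2 / v) =
      Real.exp (-((2 * Real.pi * a - Real.pi * s ^ 2 / (4 * m)) * v)) *
        Real.exp (-(4 * Real.pi * m / v) * (y + s * v / (4 * m)) ^ 2) := by
    rw [← Real.exp_add, ← Real.exp_add]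
    congr 1
    field_simp
    ring
  rw [radialKernel, mul_right_comm, h]
  ring

theorem radialKernel_nonneg {v : ℝ} (hv : 0 < v) (y : ℝ) : 0 ≤ radialKernel k m a s v y := by
  unfold radialKernel
  positivity

theorem measurable_radialKernel :
    Measurable fun p : ℝ × ℝ => radialKernel k m a s p.1 p.2 := by
  unfold radialKernel
  fun_prop

theorem integrable_radialKernel (hm : 0 < m) {v : ℝ} (hv : 0 < v) :
    Integrable (radialKernel k m a s v) := by
  rw [funext (radialKernel_eq hm hv)]
  exact ((integrable_exp_neg_mul_sq (by positivity)).comp_add_right _).const_mul _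

theorem integral_radialKernel (hm : 0 < m) {v : ℝ} (hv : 0 < v) :
    ∫ y, radialKernel k m a s v y =
      v ^ ((k + 1 / 2 : ℝ) - 1) *
        Real.exp (-((2 * Real.pi * a - Real.pi * s ^ 2 / (4 * m)) * v)) * (1 / (2 * √m)) := by
  rw [funext (radialKernel_eq hm hv), integral_const_mul,
    integral_add_right_eq_self (fun y => Real.exp (-(4 * Real.pi * m / v) * y ^ 2)),
    integral_gaussian, show Real.pi / (4 * Real.pi * m / v) = v / (2 ^ 2 * m) by
      field_simp; norm_num,
    Real.sqrt_div hv.le, Real.sqrt_mul (by positivity), Real.sqrt_sq (by positivity),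
    Real.sqrt_eq_rpow v, show (k + 1 / 2 : ℝ) - 1 = (k + 2 : ℕ) - (3 : ℕ) + 1 / 2 by
      push_cast; ring, Real.rpow_add hv, Real.rpow_sub hv, Real.rpow_natCast, Real.rpow_natCast]
  ring

theorem integrableOn_integral_radialKernel (hm : 0 < m) (hD : s ^ 2 < 8 * m * a) :
    IntegrableOn (fun v => ∫ y, radialKernel k m a s v y) (Ioi 0) ∧
    ∫ v in Ioi 0, ∫ y, radialKernel k m a s v y =
      (4 * m / (Real.pi * (8 * m * a - s ^ 2))) ^ (k + 1 / 2 : ℝ) *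
        Real.Gamma (k + 1 / 2) * (1 / (2 * √m)) := by
  have hr : 2 * Real.pi * a - Real.pi * s ^ 2 / (4 * m) =
      Real.pi * (8 * m * a - s ^ 2) / (4 * m) := by
    field_simp
    ring
  have hr0 : 0 < 2 * Real.pi * a - Real.pi * s ^ 2 / (4 * m) := by
    have := sub_pos.mpr hD
    rw [hr]
    positivity
  have hk : (0 : ℝ) < k + 1 / 2 := by positivity
  have hGamma := Real.integral_rpow_mul_exp_neg_mul_Ioi hk hr0
  have heq : EqOn (fun v => ∫ y, radialKernel k m a s v y) (fun v => v ^ ((k + 1 / 2 : ℝ) - 1) *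
        Real.exp (-((2 * Real.pi * a - Real.pi * s ^ 2 / (4 * m)) * v)) * (1 / (2 * √m)))
      (Ioi 0) := fun v hv => integral_radialKernel hm hv
  refine ⟨(integrableOn_congr_fun heq measurableSet_Ioi).mpr (Integrable.mul_const ?_ _), ?_⟩
  · refine .of_integral_ne_zero ?_
    rw [hGamma]
    have := Real.Gamma_pos_of_pos hk
    positivity
  · rw [setIntegral_congr_fun measurableSet_Ioi heq, integral_mul_const, hGamma, hr, one_div_div]

end RadialKernel

theorem volume_restrict_Reg :
    (volume : Measure (ℝ × ℝ × ℝ × ℝ)).restrict Reg =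
      (volume.restrict (Icc 0 1)).prod ((volume.restrict (Ioi 0)).prod
        ((volume.restrict (Icc 0 1)).prod volume)) := by
  simp only [Reg, Measure.volume_eq_prod, ← Measure.prod_restrict, Measure.restrict_univ]

theorem integrable_e_mul_radialKernel (k : ℕ) {m a s : ℝ} (hm : 0 < m)
    (hD : s ^ 2 < 8 * m * a) (j : ℤ) :
    Integrable (fun q : ℝ × ℝ × ℝ => e ((j : ℂ) * q.2.1) * (radialKernel k m a s q.1 q.2.2 : ℂ))
      ((volume.restrict (Ioi 0)).prod ((volume.restrict (Icc 0 1)).prod volume)) := by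
  have hmeas : Measurable fun q : ℝ × ℝ × ℝ =>
      e ((j : ℂ) * q.2.1) * (radialKernel k m a s q.1 q.2.2 : ℂ) :=
    ((continuous_e_ofReal j).measurable.comp (measurable_fst.comp measurable_snd)).mul
      (Complex.measurable_ofReal.comp (measurable_radialKernel.comp
        (measurable_fst.prodMk (measurable_snd.comp measurable_snd))))
  rw [integrable_prod_iff hmeas.aestronglyMeasurable]
  constructor
  · filter_upwards [ae_restrict_mem measurableSet_Ioi] with v hv
    exact (integrableOn_e_ofReal j).mul_prod (integrable_radialKernel hm hv).ofReal
  · refine (integrableOn_congr_fun (fun v hv => ?_) measurableSet_Ioi).mpr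
      (integrableOn_integral_radialKernel (k := k) hm hD).1
    simp only [norm_mul, norm_e_ofReal, one_mul, Complex.norm_real, Real.norm_eq_abs,
      abs_of_nonneg (radialKernel_nonneg hv _)]
    rw [integral_fun_snd]
    simp

theorem integral_e_mul_radialKernel (k : ℕ) {m a s : ℝ} (hm : 0 < m)
    (hD : s ^ 2 < 8 * m * a) (j : ℤ) :
    ∫ q : ℝ × ℝ × ℝ, e ((j : ℂ) * q.2.1) * (radialKernel k m a s q.1 q.2.2 : ℂ)
      ∂((volume.restrict (Ioi 0)).prod ((volume.restrict (Icc 0 1)).prod volume)) =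
    (if j = 0 then 1 else 0) *
      (((4 * m / (Real.pi * (8 * m * a - s ^ 2))) ^ (k + 1 / 2 : ℝ) *
        Real.Gamma (k + 1 / 2) * (1 / (2 * √m)) : ℝ) : ℂ) := by
  rw [integral_prod _ (integrable_e_mul_radialKernel k hm hD j),
    ← (integrableOn_integral_radialKernel (k := k) hm hD).2, ← integral_e_ofReal j,
    ← integral_complex_ofReal, ← integral_const_mul]
  congr 1
  ext v
  rw [← integral_complex_ofReal]
  exact integral_prod_mul (fun x : ℝ => e ((j : ℂ) * x))
    (fun y => (radialKernel k m a s v y : ℂ))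

/-- absolute convergence and evaluation of the unfolded Petersson integral
of two monomials. -/
theorem statement4 (k m n ℓ : ℕ) (r w : ℤ) (hk : 0 < k) (hm : 0 < m) (hn : 0 < n)
    (hl : 0 < ℓ) (hnr : 0 < 4 * (n : ℤ) * m - r ^ 2) (hlw : 0 < 4 * (ℓ : ℤ) * m - w ^ 2) :
    IntegrableOn (F4 k m n ℓ r w) Reg volume ∧
    ((n = ℓ ∧ r = w) →
      ∫ p in Reg, F4 k m n ℓ r w p =
        (((m : ℝ) ^ k * Real.Gamma ((k : ℝ) + 1 / 2) /
          (2 * Real.pi ^ ((k : ℝ) + 1 / 2) *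
            (4 * (ℓ : ℝ) * m - (w : ℝ) ^ 2) ^ ((k : ℝ) + 1 / 2)) : ℝ) : ℂ)) ∧
    (¬(n = ℓ ∧ r = w) → ∫ p in Reg, F4 k m n ℓ r w p = 0) := by
  have hm' : (0 : ℝ) < m := by exact_mod_cast hm
  have hD : ((r : ℝ) + w) ^ 2 < 8 * m * (n + ℓ) := by
    have h1 : (0 : ℝ) < 4 * n * m - (r : ℝ) ^ 2 := by exact_mod_cast hnr
    have h2 : (0 : ℝ) < 4 * ℓ * m - (w : ℝ) ^ 2 := by exact_mod_cast hlw
    nlinarith [sq_nonneg ((r : ℝ) - w)]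
  have hF : F4 k m n ℓ r w = fun p => e (((n - ℓ : ℤ) : ℂ) * p.1) *
      (e (((r - w : ℤ) : ℂ) * p.2.2.1) *
        (radialKernel k m (n + ℓ) (r + w) p.2.1 p.2.2.2 : ℂ)) :=
    funext fun p => F4_eq k m n ℓ r w p.1 p.2.1 p.2.2.1 p.2.2.2
  have hint : ∫ p in Reg, F4 k m n ℓ r w p =
      (if (n - ℓ : ℤ) = 0 then 1 else 0) * ((if r - w = 0 then 1 else 0) *
      (((4 * m / (Real.pi * (8 * m * (n + ℓ) - (r + w) ^ 2))) ^ (k + 1 / 2 : ℝ) *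
        Real.Gamma (k + 1 / 2) * (1 / (2 * √m)) : ℝ) : ℂ)) := by
    rw [volume_restrict_Reg, hF, ← integral_e_mul_radialKernel k hm' hD, ← integral_e_ofReal]
    exact integral_prod_mul (fun u : ℝ => e (((n - ℓ : ℤ) : ℂ) * u))
      (fun q : ℝ × ℝ × ℝ => e (((r - w : ℤ) : ℂ) * q.2.1) *
        (radialKernel k m (n + ℓ) (r + w) q.1 q.2.2 : ℂ))
  refine ⟨?_, ?_, fun h => ?_⟩
  · rw [IntegrableOn, volume_restrict_Reg, hF]
    exact Integrable.mul_prod (integrableOn_e_ofReal (n - ℓ))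
      (integrable_e_mul_radialKernel k hm' hD (r - w))
  · rintro ⟨rfl, rfl⟩
    have hpos : (0 : ℝ) < 4 * n * m - (r : ℝ) ^ 2 := by exact_mod_cast hnr
    rw [hint, sub_self, sub_self, if_pos rfl, one_mul, one_mul]
    congr 1
    rw [show 4 * (m : ℝ) / (Real.pi * (8 * m * (n + n) - (r + r) ^ 2)) =
        m / (Real.pi * (4 * n * m - (r : ℝ) ^ 2)) by
      rw [show 8 * (m : ℝ) * (n + n) - (r + r) ^ 2 = 4 * (4 * n * m - (r : ℝ) ^ 2) by ring]
      field_simp,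
      Real.div_rpow hm'.le (by positivity), Real.mul_rpow Real.pi_pos.le hpos.le,
      Real.rpow_add hm', Real.rpow_natCast, ← Real.sqrt_eq_rpow]
    have := Real.sqrt_pos.mpr hm'
    field_simp
  · rw [hint]
    rcases not_and_or.mp h with h | h
    · rw [if_neg (by omega), zero_mul]
    · rw [if_neg (c := r - w = 0) (by omega), zero_mul, mul_zero]
end
end
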